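/- arXiv:1612.07222 — 6 statements merged into one kernel-verified Lean document; each statement's English description precedes it below -/
import Mathlib

section
/- Let K ≥ 2 and let α ∈ ℝ^K satisfy α_k > 0 for all k. For a permutation π of {1,…,K} define F(π) = Σ_{(i,j) : i ≠ j, π(i) > π(j)} I_{1/2}(α_j, α_i). Then the set of permutations maximizing F equals the set Π_α = {π : for all i, j, π(i) > π(j) implies α_i ≥ α_j}. -/
open MeasureTheory Finset

/-- The Beta function `B(a,b) = ∫_0^1 t^(a-1) (1-t)^(b-1) dt`. -/
noncomputable def betaFun (a b : ℝ) : ℝ :=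
  ∫ t in Set.Ioo (0:ℝ) 1, t ^ (a - 1) * (1 - t) ^ (b - 1)

/-- The regularized incomplete beta function evaluated at `1/2`:
`I_{1/2}(a,b) = (1/B(a,b)) ∫_0^{1/2} t^(a-1) (1-t)^(b-1) dt`. -/
noncomputable def Ihalf (a b : ℝ) : ℝ :=
  (∫ t in Set.Ioo (0:ℝ) (1/2), t ^ (a - 1) * (1 - t) ^ (b - 1)) / betaFun a b

/-- `F(π) = Σ_{(i,j) : i ≠ j, π(i) > π(j)} I_{1/2}(α_j, α_i)`. -/
noncomputable def Fobj {K : ℕ} (α : Fin K → ℝ) (π : Equiv.Perm (Fin K)) : ℝ :=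
  ∑ p ∈ Finset.univ.filter (fun p : Fin K × Fin K => p.1 ≠ p.2 ∧ π p.2 < π p.1),
    Ihalf (α p.2) (α p.1)

theorem intervalIntegrable_beta_left {a : ℝ} (ha : 0 < a) (b : ℝ) :
    IntervalIntegrable (fun t : ℝ => t ^ (a - 1) * (1 - t) ^ (b - 1)) volume 0 (1 / 2) := by
  refine (intervalIntegral.intervalIntegrable_rpow' (r := a - 1) (by linarith)).mul_continuousOn ?_
  refine ContinuousOn.rpow_const (by fun_prop) fun t ht => Or.inl ?_
  rw [Set.uIcc_of_le (by norm_num)] at ht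
  linarith [ht.2]

theorem intervalIntegrable_beta {a b : ℝ} (ha : 0 < a) (hb : 0 < b) :
    IntervalIntegrable (fun t : ℝ => t ^ (a - 1) * (1 - t) ^ (b - 1)) volume 0 1 := by
  refine (intervalIntegrable_beta_left ha b).trans ?_
  have h := ((intervalIntegrable_beta_left hb a).comp_sub_left 1).symm
  norm_num at h
  simpa [mul_comm] using h

theorem betaFun_eq_intervalIntegral (a b : ℝ) :
    betaFun a b = ∫ t in (0 : ℝ)..1, t ^ (a - 1) * (1 - t) ^ (b - 1) := by
  rw [betaFun, intervalIntegral.integral_of_le zero_le_one, integral_Ioc_eq_integral_Ioo]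

theorem betaFun_pos {a b : ℝ} (ha : 0 < a) (hb : 0 < b) : 0 < betaFun a b := by
  rw [betaFun_eq_intervalIntegral]
  refine intervalIntegral.intervalIntegral_pos_of_pos_on (intervalIntegrable_beta ha hb)
    (fun t ht => ?_) zero_lt_one
  exact mul_pos (Real.rpow_pos_of_pos ht.1 _) (Real.rpow_pos_of_pos (by linarith [ht.2]) _)

theorem betaFun_comm (a b : ℝ) : betaFun a b = betaFun b a := by
  rw [betaFun_eq_intervalIntegral, betaFun_eq_intervalIntegral]
  have h := intervalIntegral.integral_comp_sub_left (a := 0) (b := 1)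
    (fun t : ℝ => t ^ (a - 1) * (1 - t) ^ (b - 1)) 1
  norm_num at h
  simpa only [mul_comm] using h.symm

theorem rpow_mul_one_sub_rpow_lt {a b t : ℝ} (hab : a < b) (ht0 : 0 < t) (ht : t < 1 / 2) :
    t ^ (b - 1) * (1 - t) ^ (a - 1) < t ^ (a - 1) * (1 - t) ^ (b - 1) := by
  have h1 : 0 < 1 - t := by linarith
  have hb : b - 1 = (a - 1) + (b - a) := by ring
  rw [hb, Real.rpow_add ht0, Real.rpow_add h1]
  have hlt : t ^ (b - a) < (1 - t) ^ (b - a) :=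
    Real.rpow_lt_rpow ht0.le (by linarith) (by linarith)
  have hpos := mul_pos (Real.rpow_pos_of_pos ht0 (a - 1)) (Real.rpow_pos_of_pos h1 (a - 1))
  nlinarith [mul_lt_mul_of_pos_left hlt hpos]

theorem Ihalf_swap_lt {a b : ℝ} (ha : 0 < a) (hab : a < b) : Ihalf b a < Ihalf a b := by
  have hb : 0 < b := ha.trans hab
  rw [Ihalf, Ihalf, betaFun_comm b a]
  refine div_lt_div_of_pos_right ?_ (betaFun_pos ha hb)
  rw [← integral_Ioc_eq_integral_Ioo, ← integral_Ioc_eq_integral_Ioo,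
    ← intervalIntegral.integral_of_le (by norm_num),
    ← intervalIntegral.integral_of_le (by norm_num), ← sub_pos,
    ← intervalIntegral.integral_sub (intervalIntegrable_beta_left ha b)
      (intervalIntegrable_beta_left hb a)]
  exact intervalIntegral.intervalIntegral_pos_of_pos_on
    ((intervalIntegrable_beta_left ha b).sub (intervalIntegrable_beta_left hb a))
    (fun t ht => sub_pos.2 (rpow_mul_one_sub_rpow_lt hab ht.1 ht.2)) (by norm_num)

theorem Ihalf_swap_le_iff {a b : ℝ} (ha : 0 < a) (hb : 0 < b) :
    Ihalf b a ≤ Ihalf a b ↔ a ≤ b := by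
  refine ⟨fun h => ?_, fun h => ?_⟩
  · by_contra! hlt
    exact (Ihalf_swap_lt hb hlt).not_ge h
  · rcases h.eq_or_lt with rfl | hlt
    · exact le_rfl
    · exact (Ihalf_swap_lt ha hlt).le

/-- The contribution of the unordered pair `{i, j}` to `Fobj α π`. -/
noncomputable def pairTerm {K : ℕ} (α : Fin K → ℝ) (π : Equiv.Perm (Fin K))
    (p : Fin K × Fin K) : ℝ :=
  (if π p.2 < π p.1 then Ihalf (α p.2) (α p.1) else 0) +
    if π p.1 < π p.2 then Ihalf (α p.1) (α p.2) else 0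

/-- The largest possible contribution of the unordered pair `{i, j}`. -/
noncomputable def pairMax {K : ℕ} (α : Fin K → ℝ) (p : Fin K × Fin K) : ℝ :=
  if p.1 = p.2 then 0 else max (Ihalf (α p.2) (α p.1)) (Ihalf (α p.1) (α p.2))

theorem two_mul_Fobj {K : ℕ} (α : Fin K → ℝ) (π : Equiv.Perm (Fin K)) :
    2 * Fobj α π = ∑ p, pairTerm α π p := by
  have hF : Fobj α π = ∑ p : Fin K × Fin K,
      if π p.2 < π p.1 then Ihalf (α p.2) (α p.1) else 0 := by
    rw [Fobj, Finset.sum_filter]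
    refine Finset.sum_congr rfl fun p _ => if_congr ?_ rfl rfl
    exact ⟨And.right, fun h => ⟨fun he => by simp [he] at h, h⟩⟩
  have hswap : Fobj α π = ∑ p : Fin K × Fin K,
      if π p.1 < π p.2 then Ihalf (α p.1) (α p.2) else 0 := by
    rw [hF]
    exact Fintype.sum_equiv (Equiv.prodComm _ _) _ _ fun _ => rfl
  simp only [pairTerm, Finset.sum_add_distrib, ← hF, ← hswap]
  ring

theorem pairTerm_le_pairMax {K : ℕ} (α : Fin K → ℝ) (π : Equiv.Perm (Fin K))
    (p : Fin K × Fin K) : pairTerm α π p ≤ pairMax α p := by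
  obtain ⟨i, j⟩ := p
  rcases lt_trichotomy (π i) (π j) with h | h | h
  · have hne : i ≠ j := fun he => by simp [he] at h
    simp [pairTerm, pairMax, h, h.not_gt, hne]
  · simp [pairTerm, pairMax, π.injective h]
  · have hne : i ≠ j := fun he => by simp [he] at h
    simp [pairTerm, pairMax, h, h.not_gt, hne]

theorem two_mul_Fobj_le {K : ℕ} (α : Fin K → ℝ) (π : Equiv.Perm (Fin K)) :
    2 * Fobj α π ≤ ∑ p, pairMax α p := by
  rw [two_mul_Fobj]
  exact Finset.sum_le_sum fun p _ => pairTerm_le_pairMax α π p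

theorem two_mul_Fobj_eq_iff {K : ℕ} {α : Fin K → ℝ} (hα : ∀ k, 0 < α k)
    (π : Equiv.Perm (Fin K)) :
    2 * Fobj α π = ∑ p, pairMax α p ↔ ∀ i j : Fin K, π j < π i → α j ≤ α i := by
  rw [two_mul_Fobj, Finset.sum_eq_sum_iff_of_le fun p _ => pairTerm_le_pairMax α π p]
  refine ⟨fun h i j hij => ?_, fun h p _ => ?_⟩
  · have hne : i ≠ j := fun he => by simp [he] at hij
    have hp := h (i, j) (Finset.mem_univ _)
    simp only [pairTerm, pairMax, hij, hij.not_gt, hne, if_true, if_false, add_zero] at hp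
    exact (Ihalf_swap_le_iff (hα j) (hα i)).1 (max_eq_left_iff.1 hp.symm)
  · obtain ⟨i, j⟩ := p
    rcases lt_trichotomy (π i) (π j) with hij | hij | hij
    · have hne : i ≠ j := fun he => by simp [he] at hij
      simpa [pairTerm, pairMax, hij, hij.not_gt, hne] using
        (Ihalf_swap_le_iff (hα i) (hα j)).2 (h j i hij)
    · simp [pairTerm, pairMax, π.injective hij]
    · have hne : i ≠ j := fun he => by simp [he] at hij
      simpa [pairTerm, pairMax, hij, hij.not_gt, hne] using
        (Ihalf_swap_le_iff (hα j) (hα i)).2 (h i j hij)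

theorem exists_sorting_perm {K : ℕ} (α : Fin K → ℝ) :
    ∃ π : Equiv.Perm (Fin K), ∀ i j : Fin K, π j < π i → α j ≤ α i :=
  ⟨(Tuple.sort α)⁻¹, fun i j h => by simpa using Tuple.monotone_sort α h.le⟩

/-- The set of permutations maximizing `F` is exactly the set of permutations
that sort `α` in nondecreasing order of rank. -/
theorem maximizers_eq_sorting (K : ℕ) (hK : 2 ≤ K) (α : Fin K → ℝ)
    (hα : ∀ k, 0 < α k) :
    {π : Equiv.Perm (Fin K) | ∀ σ : Equiv.Perm (Fin K), Fobj α σ ≤ Fobj α π}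
      = {π : Equiv.Perm (Fin K) | ∀ i j : Fin K, π j < π i → α j ≤ α i} := by
  ext π
  rw [Set.mem_ofPred_eq, Set.mem_ofPred_eq, ← two_mul_Fobj_eq_iff hα]
  refine ⟨fun h => (two_mul_Fobj_le α π).antisymm ?_, fun h σ => ?_⟩
  · obtain ⟨σ, hσ⟩ := exists_sorting_perm α
    linarith [(two_mul_Fobj_eq_iff hα σ).2 hσ, h σ]
  · linarith [two_mul_Fobj_le α σ]
end

section
/- Let a > b > 0 and let (c_s)_{s ∈ S} be a finite family of positive real numbers. Then I_{1/2}(b,a) + Σ_{s∈S} I_{1/2}(b,c_s) + Σ_{s∈S} I_{1/2}(c_s,a) > I_{1/2}(a,b) + Σ_{s∈S} I_{1/2}(c_s,b) + Σ_{s∈S} I_{1/2}(a,c_s). -/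
open MeasureTheory Finset

/-- The lower half of the Beta integral, as an interval integral. -/
noncomputable def lowerBeta (a b : ℝ) : ℝ :=
  ∫ t in (0:ℝ)..(1/2), t ^ (a - 1) * (1 - t) ^ (b - 1)

theorem intervalIntegrable_lowerBeta {a : ℝ} (ha : 0 < a) (b : ℝ) :
    IntervalIntegrable (fun t : ℝ => t ^ (a - 1) * (1 - t) ^ (b - 1)) volume 0 (1/2) := by
  apply IntervalIntegrable.mul_continuousOn
  · exact intervalIntegral.intervalIntegrable_rpow' (by linarith)
  · intro t ht
    rw [Set.uIcc_of_le (by norm_num)] at ht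
    have h : (1 - t) ≠ 0 := by linarith [ht.2]
    exact ((continuousAt_const.sub continuousAt_id).rpow_const (Or.inl h)).continuousWithinAt

theorem lowerBeta_pos {a : ℝ} (ha : 0 < a) (b : ℝ) : 0 < lowerBeta a b := by
  refine intervalIntegral.intervalIntegral_pos_of_pos_on (intervalIntegrable_lowerBeta ha b)
    (fun t ht => ?_) (by norm_num)
  exact mul_pos (Real.rpow_pos_of_pos ht.1 _) (Real.rpow_pos_of_pos (by linarith [ht.2]) _)

theorem betaFun_eq_lowerBeta_add {a b : ℝ} (ha : 0 < a) (hb : 0 < b) :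
    betaFun a b = lowerBeta a b + lowerBeta b a := by
  have hreflect : (fun t : ℝ => (1 - t) ^ (b - 1) * (1 - (1 - t)) ^ (a - 1))
      = fun t : ℝ => t ^ (a - 1) * (1 - t) ^ (b - 1) := by
    funext t
    rw [sub_sub_cancel, mul_comm]
  have hint : IntervalIntegrable (fun t : ℝ => t ^ (a - 1) * (1 - t) ^ (b - 1))
      volume (1/2) 1 := by
    have h := ((intervalIntegrable_lowerBeta hb a).comp_sub_left 1).symm
    rw [hreflect] at h
    norm_num at h ⊢
    exact h
  have hupper : ∫ t in (1/2:ℝ)..1, t ^ (a - 1) * (1 - t) ^ (b - 1) = lowerBeta b a := by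
    have h := intervalIntegral.integral_comp_sub_left (a := 1/2) (b := 1)
      (fun t : ℝ => t ^ (b - 1) * (1 - t) ^ (a - 1)) 1
    rw [hreflect] at h
    rw [h, lowerBeta]
    norm_num
  rw [betaFun, ← integral_Ioc_eq_integral_Ioo,
    ← intervalIntegral.integral_of_le zero_le_one, ← hupper, lowerBeta,
    intervalIntegral.integral_add_adjacent_intervals (intervalIntegrable_lowerBeta ha b) hint]

theorem Ihalf_eq {a b : ℝ} (ha : 0 < a) (hb : 0 < b) :
    Ihalf a b = lowerBeta a b / (lowerBeta a b + lowerBeta b a) := by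
  rw [Ihalf, betaFun_eq_lowerBeta_add ha hb, ← integral_Ioc_eq_integral_Ioo,
    ← intervalIntegral.integral_of_le (by norm_num), ← lowerBeta]

theorem Ihalf_add_swap {a b : ℝ} (ha : 0 < a) (hb : 0 < b) : Ihalf a b + Ihalf b a = 1 := by
  have h₁ := lowerBeta_pos ha b
  have h₂ := lowerBeta_pos hb a
  rw [Ihalf_eq ha hb, Ihalf_eq hb ha, add_comm (lowerBeta b a), ← add_div]
  exact div_self (by positivity)

theorem lowerBeta_lt_mul_of_lt_left {a b : ℝ} (hb : 0 < b) (hab : b < a) (c : ℝ) :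
    lowerBeta a c < (1/2) ^ (a - b) * lowerBeta b c := by
  have hi := (intervalIntegrable_lowerBeta hb c).const_mul ((1/2) ^ (a - b))
  have hj := intervalIntegrable_lowerBeta (hb.trans hab) c
  have h := intervalIntegral.intervalIntegral_pos_of_pos_on (hi.sub hj)
    (fun t ht => ?_) (by norm_num)
  · rw [intervalIntegral.integral_sub hi hj, intervalIntegral.integral_const_mul] at h
    exact sub_pos.mp h
  · have h₁ : t ^ (a - 1) = t ^ (a - b) * t ^ (b - 1) := by
      rw [← Real.rpow_add ht.1]; ring_nf
    have h₂ : t ^ (a - b) < (1/2) ^ (a - b) :=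
      Real.rpow_lt_rpow ht.1.le ht.2 (sub_pos.mpr hab)
    have h₃ : 0 < t ^ (b - 1) * (1 - t) ^ (c - 1) :=
      mul_pos (Real.rpow_pos_of_pos ht.1 _) (Real.rpow_pos_of_pos (by linarith [ht.2]) _)
    simp only [h₁, mul_assoc]
    exact sub_pos.mpr (mul_lt_mul_of_pos_right h₂ h₃)

theorem mul_lowerBeta_le_of_le_right {a b c : ℝ} (hc : 0 < c) (hab : b ≤ a) :
    (1/2) ^ (a - b) * lowerBeta c b ≤ lowerBeta c a := by
  rw [lowerBeta, ← intervalIntegral.integral_const_mul]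
  refine intervalIntegral.integral_mono_on_of_le_Ioo (by norm_num)
    ((intervalIntegrable_lowerBeta hc b).const_mul _) (intervalIntegrable_lowerBeta hc a)
    fun t ht => ?_
  have ht' : 0 < 1 - t := by linarith [ht.2]
  have h₁ : (1 - t) ^ (a - 1) = (1 - t) ^ (a - b) * (1 - t) ^ (b - 1) := by
    rw [← Real.rpow_add ht']; ring_nf
  have h₂ : (1/2) ^ (a - b) ≤ (1 - t) ^ (a - b) :=
    Real.rpow_le_rpow (by norm_num) (by linarith [ht.2]) (sub_nonneg.mpr hab)
  have h₃ : 0 < t ^ (c - 1) * (1 - t) ^ (b - 1) :=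
    mul_pos (Real.rpow_pos_of_pos ht.1 _) (Real.rpow_pos_of_pos ht' _)
  rw [h₁, mul_left_comm (t ^ (c - 1))]
  exact mul_le_mul_of_nonneg_right h₂ h₃.le

theorem Ihalf_lt_of_lt_left {a b c : ℝ} (hb : 0 < b) (hab : b < a) (hc : 0 < c) :
    Ihalf a c < Ihalf b c := by
  have ha := hb.trans hab
  have h₁ := lowerBeta_pos ha c
  have h₂ := lowerBeta_pos hb c
  have h₃ := lowerBeta_pos hc a
  have h₄ := lowerBeta_pos hc b
  have key : lowerBeta a c * lowerBeta c b < lowerBeta b c * lowerBeta c a :=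
    calc lowerBeta a c * lowerBeta c b
        < (1/2) ^ (a - b) * lowerBeta b c * lowerBeta c b :=
          mul_lt_mul_of_pos_right (lowerBeta_lt_mul_of_lt_left hb hab c) h₄
      _ = lowerBeta b c * ((1/2) ^ (a - b) * lowerBeta c b) := by ring
      _ ≤ lowerBeta b c * lowerBeta c a :=
          mul_le_mul_of_nonneg_left (mul_lowerBeta_le_of_le_right hc hab.le) h₂.le
  rw [Ihalf_eq ha hc, Ihalf_eq hb hc, div_lt_div_iff₀ (by positivity) (by positivity)]
  linarith

theorem Ihalf_lt_of_lt_right {a b c : ℝ} (hb : 0 < b) (hab : b < a) (hc : 0 < c) :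
    Ihalf c b < Ihalf c a := by
  linarith [Ihalf_lt_of_lt_left hb hab hc, Ihalf_add_swap hc hb, Ihalf_add_swap hc (hb.trans hab)]

/-- Swapping a larger score `a` ahead of a smaller score `b` strictly increases
the total of regularized incomplete beta values. -/
theorem swap_increases {ι : Type*} (a b : ℝ) (hb : 0 < b) (hab : b < a)
    (S : Finset ι) (c : ι → ℝ) (hc : ∀ s ∈ S, 0 < c s) :
    Ihalf a b + ∑ s ∈ S, Ihalf (c s) b + ∑ s ∈ S, Ihalf a (c s)
      < Ihalf b a + ∑ s ∈ S, Ihalf b (c s) + ∑ s ∈ S, Ihalf (c s) a := by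
  have h₀ : Ihalf a b < Ihalf b a :=
    (Ihalf_lt_of_lt_left hb hab hb).trans (Ihalf_lt_of_lt_right hb hab hb)
  have h₁ : ∑ s ∈ S, Ihalf (c s) b ≤ ∑ s ∈ S, Ihalf (c s) a :=
    sum_le_sum fun s hs => (Ihalf_lt_of_lt_right hb hab (hc s hs)).le
  have h₂ : ∑ s ∈ S, Ihalf a (c s) ≤ ∑ s ∈ S, Ihalf b (c s) :=
    sum_le_sum fun s hs => (Ihalf_lt_of_lt_left hb hab (hc s hs)).le
  linarith
end

section
/- For every fixed b > 0, the function a ↦ I_{1/2}(a,b) is strictly decreasing on (0,∞), and for every fixed a > 0, the function b ↦ I_{1/2}(a,b) is strictly increasing on (0,∞). -/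
open MeasureTheory

theorem setIntegral_pos_of_forall_pos {α : Type*} [MeasurableSpace α] {μ : Measure α}
    {s : Set α} {f : α → ℝ} (hs : MeasurableSet s) (hμ : 0 < μ s)
    (hf : IntegrableOn f s μ) (hpos : ∀ x ∈ s, 0 < f x) : 0 < ∫ x in s, f x ∂μ := by
  rw [setIntegral_pos_iff_support_of_nonneg_ae
    (ae_restrict_of_forall_mem hs fun x hx => (hpos x hx).le) hf]
  rwa [Set.inter_eq_right.2 fun x hx => Function.mem_support.2 (hpos x hx).ne']

/-- If the density ratio `g / f` is below `c` on `(0, 1/2)` and at least `c` on `[1/2, 1)`, then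
`g` gives a smaller proportion of its mass to `(0, 1/2)` than `f` does. -/
theorem setIntegral_div_lt_setIntegral_div {f g : ℝ → ℝ} {c : ℝ}
    (hf : IntegrableOn f (Set.Ioo 0 1)) (hg : IntegrableOn g (Set.Ioo 0 1))
    (hfpos : ∀ t ∈ Set.Ioo (0 : ℝ) 1, 0 < f t) (hgpos : ∀ t ∈ Set.Ioo (0 : ℝ) 1, 0 < g t)
    (hleft : ∀ t ∈ Set.Ioo (0 : ℝ) (1 / 2), g t < c * f t)
    (hright : ∀ t ∈ Set.Ico (1 / 2 : ℝ) 1, c * f t ≤ g t) :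
    (∫ t in Set.Ioo (0 : ℝ) (1 / 2), g t) / (∫ t in Set.Ioo (0 : ℝ) 1, g t) <
      (∫ t in Set.Ioo (0 : ℝ) (1 / 2), f t) / (∫ t in Set.Ioo (0 : ℝ) 1, f t) := by
  have hU : Set.Ioo (0 : ℝ) (1 / 2) ∪ Set.Ico (1 / 2) 1 = Set.Ioo 0 1 :=
    Set.Ioo_union_Ico_eq_Ioo (by norm_num) (by norm_num)
  have hL : Set.Ioo (0 : ℝ) (1 / 2) ⊆ Set.Ioo 0 1 := hU ▸ Set.subset_union_left
  have hR : Set.Ico (1 / 2 : ℝ) 1 ⊆ Set.Ioo 0 1 := hU ▸ Set.subset_union_right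
  have hd : Disjoint (Set.Ioo (0 : ℝ) (1 / 2)) (Set.Ico (1 / 2) 1) :=
    Set.disjoint_left.2 fun t h₁ h₂ => absurd h₁.2 h₂.1.not_gt
  have hμL : 0 < volume (Set.Ioo (0 : ℝ) (1 / 2)) := by simp
  have hμR : 0 < volume (Set.Ico (1 / 2 : ℝ) 1) := by
    rw [Real.volume_Ico, ENNReal.ofReal_pos]; norm_num
  have split : ∀ {h : ℝ → ℝ}, IntegrableOn h (Set.Ioo 0 1) → ∫ t in Set.Ioo (0 : ℝ) 1, h t =
      (∫ t in Set.Ioo (0 : ℝ) (1 / 2), h t) + ∫ t in Set.Ico (1 / 2 : ℝ) 1, h t := fun hh => by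
    rw [← hU, setIntegral_union hd measurableSet_Ico (hh.mono_set hL) (hh.mono_set hR)]
  have hFL := setIntegral_pos_of_forall_pos measurableSet_Ioo hμL (hf.mono_set hL)
    fun t ht => hfpos t (hL ht)
  have hFR := setIntegral_pos_of_forall_pos measurableSet_Ico hμR (hf.mono_set hR)
    fun t ht => hfpos t (hR ht)
  have hGL := setIntegral_pos_of_forall_pos measurableSet_Ioo hμL (hg.mono_set hL)
    fun t ht => hgpos t (hL ht)
  have hGR := setIntegral_pos_of_forall_pos measurableSet_Ico hμR (hg.mono_set hR)
    fun t ht => hgpos t (hR ht)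
  have h₁ := setIntegral_pos_of_forall_pos measurableSet_Ioo hμL
    (((hf.mono_set hL).const_mul c).sub (hg.mono_set hL)) fun t ht => sub_pos.2 (hleft t ht)
  simp only [Pi.sub_apply] at h₁
  rw [integral_sub ((hf.mono_set hL).const_mul c) (hg.mono_set hL), integral_const_mul] at h₁
  have h₂ := setIntegral_mono_on ((hf.mono_set hR).const_mul c) (hg.mono_set hR)
    measurableSet_Ico hright
  rw [integral_const_mul] at h₂
  rw [split hf, split hg, div_lt_div_iff₀ (by positivity) (by positivity)]
  nlinarith [mul_pos h₁ hFR, mul_le_mul_of_nonneg_left h₂ hFL.le]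

theorem integrableOn_rpow_mul_one_sub_rpow {a b : ℝ} (ha : 0 < a) (hb : 0 < b) :
    IntegrableOn (fun t : ℝ => t ^ (a - 1) * (1 - t) ^ (b - 1)) (Set.Ioo 0 1) := by
  have h := Complex.betaIntegral_convergent (u := a) (v := b) (by simpa) (by simpa)
  rw [intervalIntegrable_iff_integrableOn_Ioo_of_le zero_le_one] at h
  refine IntegrableOn.congr_fun h.re (fun t ht => ?_) measurableSet_Ioo
  have h₁ : (0 : ℝ) ≤ 1 - t := by linarith [ht.2]
  have : (t : ℂ) ^ ((a : ℂ) - 1) * (1 - (t : ℂ)) ^ ((b : ℂ) - 1) =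
      ((t ^ (a - 1) * (1 - t) ^ (b - 1) : ℝ) : ℂ) := by
    push_cast [Complex.ofReal_cpow ht.1.le, Complex.ofReal_cpow h₁]
    rfl
  simp [this]

theorem rpow_mul_one_sub_rpow_pos (a b : ℝ) {t : ℝ} (ht : t ∈ Set.Ioo (0 : ℝ) 1) :
    0 < t ^ (a - 1) * (1 - t) ^ (b - 1) :=
  mul_pos (Real.rpow_pos_of_pos ht.1 _) (Real.rpow_pos_of_pos (sub_pos.2 ht.2) _)

/-- `I_{1/2}(a,b)` is strictly decreasing in `a` on `(0,∞)` for fixed `b > 0`,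
and strictly increasing in `b` on `(0,∞)` for fixed `a > 0`. -/
theorem Ihalf_strictAnti_strictMono :
    (∀ b : ℝ, 0 < b → StrictAntiOn (fun a => Ihalf a b) (Set.Ioi (0:ℝ))) ∧
    (∀ a : ℝ, 0 < a → StrictMonoOn (fun b => Ihalf a b) (Set.Ioi (0:ℝ))) := by
  refine ⟨fun b hb x hx y hy hxy => ?_, fun a ha x hx y hy hxy => ?_⟩
  · have key : ∀ t : ℝ, 0 < t → t ^ (y - 1) = t ^ (y - x) * t ^ (x - 1) := fun t ht => by
      rw [← Real.rpow_add ht]; ring_nf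
    refine setIntegral_div_lt_setIntegral_div (c := (1 / 2 : ℝ) ^ (y - x))
      (integrableOn_rpow_mul_one_sub_rpow hx hb) (integrableOn_rpow_mul_one_sub_rpow hy hb)
      (fun t => rpow_mul_one_sub_rpow_pos x b) (fun t => rpow_mul_one_sub_rpow_pos y b)
      (fun t ht => ?_) (fun t ht => ?_)
    · have h := rpow_mul_one_sub_rpow_pos x b ⟨ht.1, by linarith [ht.2]⟩
      rw [key t ht.1, mul_assoc]
      exact mul_lt_mul_of_pos_right (Real.rpow_lt_rpow ht.1.le ht.2 (sub_pos.2 hxy)) h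
    · have ht0 : 0 < t := by linarith [ht.1]
      have h := rpow_mul_one_sub_rpow_pos x b ⟨ht0, ht.2⟩
      rw [key t ht0, mul_assoc (t ^ (y - x))]
      exact mul_le_mul_of_nonneg_right
        (Real.rpow_le_rpow (by norm_num) ht.1 (sub_pos.2 hxy).le) h.le
  · have key : ∀ t : ℝ, 0 < t → t ^ (x - 1) = t ^ (x - y) * t ^ (y - 1) := fun t ht => by
      rw [← Real.rpow_add ht]; ring_nf
    refine setIntegral_div_lt_setIntegral_div (c := (1 / 2 : ℝ) ^ (x - y))
      (integrableOn_rpow_mul_one_sub_rpow ha hy) (integrableOn_rpow_mul_one_sub_rpow ha hx)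
      (fun t => rpow_mul_one_sub_rpow_pos a y) (fun t => rpow_mul_one_sub_rpow_pos a x)
      (fun t ht => ?_) (fun t ht => ?_)
    · have h := rpow_mul_one_sub_rpow_pos a y ⟨ht.1, by linarith [ht.2]⟩
      rw [key (1 - t) (by linarith [ht.2]), mul_left_comm]
      exact mul_lt_mul_of_pos_right (Real.rpow_lt_rpow_of_neg (by norm_num)
        (by linarith [ht.2]) (sub_neg.2 hxy)) h
    · have h := rpow_mul_one_sub_rpow_pos a y ⟨by linarith [ht.1], ht.2⟩
      rw [key (1 - t) (by linarith [ht.2]), mul_left_comm (t ^ (a - 1))]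
      exact mul_le_mul_of_nonneg_right (Real.rpow_le_rpow_of_nonpos (by linarith [ht.2])
        (by linarith [ht.1]) (sub_neg.2 hxy).le) h.le
end

section
/- Let K ≥ 2 and let α ∈ ℝ^K satisfy α_k > 0 for all k. For a permutation π of {1,…,K} define F(π) = Σ_{(i,j) : i ≠ j, π(i) > π(j)} I_{1/2}(α_j, α_i). If π and π' are two permutations such that, for all i, j, π(i) > π(j) implies α_i ≥ α_j and π'(i) > π'(j) implies α_i ≥ α_j, then F(π) = F(π'). -/
open MeasureTheory Finset

/-- If a permutation sorts `α`, then listing `α` in the order of the permutation is monotone. -/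
theorem monotone_comp_symm_of_sorting {K : ℕ} {α : Fin K → ℝ} {π : Equiv.Perm (Fin K)}
    (hπ : ∀ i j : Fin K, π j < π i → α j ≤ α i) : Monotone (α ∘ π.symm) := by
  intro a b hab
  rcases hab.eq_or_lt with rfl | hlt
  · exact le_rfl
  · exact hπ _ _ (by simpa using hlt)

/-- `Fobj α π` depends only on `α` listed in the order of `π`. -/
theorem Fobj_eq_sum_positions {K : ℕ} (α : Fin K → ℝ) (π : Equiv.Perm (Fin K)) :
    Fobj α π = ∑ p ∈ Finset.univ.filter (fun p : Fin K × Fin K => p.2 < p.1),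
      Ihalf ((α ∘ π.symm) p.2) ((α ∘ π.symm) p.1) := by
  refine Finset.sum_equiv (π.prodCongr π) (fun p => ?_) (fun p _ => by simp)
  simp only [Finset.mem_filter, Finset.mem_univ, true_and, Equiv.prodCongr_apply, Prod.map_fst,
    Prod.map_snd, and_iff_right_iff_imp]
  rintro h heq
  exact h.ne (by rw [heq])

/-- Any two permutations that sort `α` give the same value of `F`. -/
theorem Fobj_eq_of_sorting (K : ℕ) (hK : 2 ≤ K) (α : Fin K → ℝ)
    (hα : ∀ k, 0 < α k) (π π' : Equiv.Perm (Fin K))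
    (hπ : ∀ i j : Fin K, π j < π i → α j ≤ α i)
    (hπ' : ∀ i j : Fin K, π' j < π' i → α j ≤ α i) :
    Fobj α π = Fobj α π' := by
  have h : α ∘ π.symm = α ∘ π'.symm :=
    Tuple.unique_monotone (monotone_comp_symm_of_sorting hπ) (monotone_comp_symm_of_sorting hπ')
  rw [Fobj_eq_sum_positions, Fobj_eq_sum_positions, h]
end

section
/- Let K ≥ 2, let α ∈ ℝ^K with α_k > 0 for all k, let α_0 = Σ_k α_k, and let i ≠ j be indices in {1,…,K}. Then: (a) ∫_Δ θ_i · (θ_i/(θ_i+θ_j)) · D_α(θ) dθ = [α_i(α_i+1) / (α_0(α_i+α_j+1))] · ∫_Δ D_α(θ) dθ; (b) ∫_Δ θ_j · (θ_i/(θ_i+θ_j)) · D_α(θ) dθ = [α_i α_j / (α_0(α_i+α_j+1))] · ∫_Δ D_α(θ) dθ; (c) for every index k with k ≠ i and k ≠ j, ∫_Δ θ_k · (θ_i/(θ_i+θ_j)) · D_α(θ) dθ = [α_k α_i / (α_0(α_i+α_j))] · ∫_Δ D_α(θ) dθ. -/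
open MeasureTheory Finset

/-- The parametrizing domain `{y ∈ ℝ^{K-1} : y_k > 0, Σ y_k < 1}` of the open
probability simplex on `K` coordinates. -/
def simplexDomain (K : ℕ) : Set (Fin (K - 1) → ℝ) :=
  {y | (∀ k, 0 < y k) ∧ ∑ k, y k < 1}

/-- The point of the simplex with coordinates `θ_k = y_k` for `k < K-1` and
`θ_K = 1 - Σ y_k`. -/
noncomputable def coordsOf {K : ℕ} (y : Fin (K - 1) → ℝ) : Fin K → ℝ :=
  fun i => if h : (i : ℕ) < K - 1 then y ⟨(i : ℕ), h⟩ else 1 - ∑ k, y k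

/-- `∫_Δ f(θ) dθ`, the integral of `f` over the open probability simplex via the
standard parametrization. -/
noncomputable def simplexIntegral (K : ℕ) (f : (Fin K → ℝ) → ℝ) : ℝ :=
  ∫ y in simplexDomain K, f (coordsOf y)

/-- The unnormalized Dirichlet density `D_α(θ) = ∏ θ_k^(α_k - 1)`. -/
noncomputable def dirDensity {K : ℕ} (α : Fin K → ℝ) (θ : Fin K → ℝ) : ℝ :=
  ∏ k, θ k ^ (α k - 1)

open scoped ENNReal

theorem lintegral_fin_prod_eq_prod {n : ℕ} {f : Fin n → ℝ → ℝ≥0∞} (hf : ∀ k, Measurable (f k)) :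
    ∫⁻ x : Fin n → ℝ, ∏ k, f k (x k) = ∏ k, ∫⁻ t, f k t := by
  induction n with
  | zero => simp [volume_pi]
  | succ n ih =>
    rw [← (volume_preserving_piFinSuccAbove (fun _ : Fin (n + 1) => ℝ) 0).symm.lintegral_comp_emb
      (MeasurableEquiv.measurableEmbedding _), Measure.volume_eq_prod,
      lintegral_prod _ (by fun_prop), Fin.prod_univ_succ, ← ih fun k => hf k.succ]
    simp only [MeasurableEquiv.piFinSuccAbove_symm_apply, Fin.insertNthEquiv, Equiv.coe_fn_mk,
      Fin.prod_univ_succ, Fin.insertNth_zero, Fin.cons_zero, Fin.cons_succ, cast_eq]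
    have h : Measurable fun y : Fin n → ℝ => ∏ k, f k.succ (y k) := by fun_prop
    simp_rw [lintegral_const_mul _ h]
    exact lintegral_mul_const _ (hf 0)

theorem lintegral_comp_smul_pi {n : ℕ} {g : (Fin n → ℝ) → ℝ≥0∞} (hg : Measurable g) {t : ℝ}
    (ht : 0 < t) :
    ∫⁻ y, g y = ENNReal.ofReal (t ^ n) * ∫⁻ y, g (t • y) := by
  rw [← lintegral_map hg (measurable_const_smul t), Measure.map_addHaar_smul _ ht.ne',
    lintegral_smul_measure, smul_eq_mul, ← mul_assoc, ← ENNReal.ofReal_mul (by positivity)]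
  have : t ^ n * |(t ^ n)⁻¹| = 1 := by
    rw [abs_of_pos (by positivity)]; field_simp
  rw [Module.finrank_fin_fun, this, ENNReal.ofReal_one, one_mul]

theorem lintegral_rpow_mul_exp {a r : ℝ} (ha : 0 < a) (hr : 0 < r) :
    ∫⁻ t in Set.Ioi (0 : ℝ), ENNReal.ofReal (t ^ (a - 1) * Real.exp (-(r * t)))
      = ENNReal.ofReal ((1 / r) ^ a * Real.Gamma a) := by
  have h := Real.integral_rpow_mul_exp_neg_mul_Ioi ha hr
  have hG := Real.Gamma_pos_of_pos ha
  rw [← h, ofReal_integral_eq_lintegral_ofReal]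
  · refine Integrable.of_integral_ne_zero ?_
    rw [h]; positivity
  · refine ae_restrict_of_forall_mem measurableSet_Ioi fun t (ht : 0 < t) => ?_
    show 0 ≤ _
    positivity

theorem lintegral_one_add_rpow {b : ℝ} (hb : 1 < b) :
    ∫⁻ u in Set.Ioi (0 : ℝ), ENNReal.ofReal ((1 / (1 + u)) ^ b)
      = ENNReal.ofReal (1 / (b - 1)) := by
  have h := integral_Ioi_rpow_of_lt (a := -b) (by linarith) one_pos
  have h1 : ∫⁻ u in Set.Ioi (0 : ℝ), ENNReal.ofReal ((1 / (1 + u)) ^ b)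
      = ∫⁻ u in Set.Ioi (1 : ℝ), ENNReal.ofReal (u ^ (-b)) := by
    rw [← lintegral_indicator measurableSet_Ioi, ← lintegral_indicator measurableSet_Ioi,
      ← lintegral_add_left_eq_self (Set.indicator (Set.Ioi 1) _) (1 : ℝ)]
    refine lintegral_congr fun u => ?_
    by_cases hu : 0 < u
    · have h1u : 0 < 1 + u := by linarith
      simp [Set.indicator, hu, Real.rpow_neg h1u.le, Real.inv_rpow h1u.le]
    · simp [Set.indicator, hu]
  rw [h1, ← ofReal_integral_eq_lintegral_ofReal
    (integrableOn_Ioi_rpow_of_lt (by linarith) one_pos), h]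
  · congr 1
    rw [Real.one_rpow, neg_div, ← div_neg]
    congr 1; ring
  · refine ae_restrict_of_forall_mem measurableSet_Ioi fun t (ht : 1 < t) => ?_
    show 0 ≤ _
    positivity

/-- Integrating a homogeneous function against `exp (-∑ x)` reduces to integrating it over the
hyperplane `∑ x = 1`. -/
theorem lintegral_homogeneous_mul_exp {n : ℕ} {g : (Fin (n + 1) → ℝ) → ℝ≥0∞} (hg : Measurable g)
    {d : ℝ} (hd : 0 < d + n + 1)
    (hhom : ∀ t : ℝ, 0 < t → ∀ x, g (t • x) = ENNReal.ofReal (t ^ d) * g x)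
    (hzero : ∀ x, ∑ k, x k ≤ 0 → g x = 0) :
    ∫⁻ x, g x * ENNReal.ofReal (Real.exp (-∑ k, x k))
      = ENNReal.ofReal (Real.Gamma (d + n + 1))
        * ∫⁻ y : Fin n → ℝ, g (Fin.snoc y (1 - ∑ k, y k)) := by
  have hsnoc : Measurable fun p : ℝ × (Fin n → ℝ) =>
      (Fin.snoc p.2 (p.1 - ∑ k, p.2 k) : Fin (n + 1) → ℝ) := by
    refine measurable_pi_iff.2 fun k => ?_
    induction k using Fin.lastCases with
    | last => simp only [Fin.snoc_last]; fun_prop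
    | cast k => simp only [Fin.snoc_castSucc]; fun_prop
  have hslice : ∀ t : ℝ, Measurable fun y : Fin n → ℝ => g (Fin.snoc y (t - ∑ k, y k)) :=
    fun t => hg.comp (hsnoc.comp (measurable_const.prodMk measurable_id))
  have hsum : ∀ (t : ℝ) (y : Fin n → ℝ),
      ∑ k, (Fin.snoc y (t - ∑ k, y k) : Fin (n + 1) → ℝ) k = t := by
    intro t y
    simp [Fin.sum_univ_castSucc]
  have hscale : ∀ (t : ℝ) (y : Fin n → ℝ),
      (Fin.snoc (t • y) (t - ∑ k, (t • y) k) : Fin (n + 1) → ℝ)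
        = t • (Fin.snoc y (1 - ∑ k, y k) : Fin (n + 1) → ℝ) := by
    intro t y
    funext k
    induction k using Fin.lastCases with
    | last => simp [← mul_sum, mul_sub]
    | cast k => simp
  set L := ∫⁻ y : Fin n → ℝ, g (Fin.snoc y (1 - ∑ k, y k)) with hL
  have hinner : ∀ t : ℝ, ∫⁻ y : Fin n → ℝ, g (Fin.snoc y (t - ∑ k, y k))
      = (Set.Ioi (0 : ℝ)).indicator (fun t => ENNReal.ofReal (t ^ (d + n))) t * L := by
    intro t
    by_cases ht : 0 < t
    · rw [lintegral_comp_smul_pi (hslice t) ht]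
      simp_rw [hscale, hhom t ht]
      rw [lintegral_const_mul _ (hslice 1), ← hL, ← mul_assoc,
        ← ENNReal.ofReal_mul (by positivity), Set.indicator_of_mem (by exact ht),
        Real.rpow_add ht, Real.rpow_natCast, mul_comm (t ^ n)]
    · rw [Set.indicator_of_notMem (by exact ht), zero_mul]
      rw [← lintegral_zero (μ := (volume : Measure (Fin n → ℝ)))]
      exact lintegral_congr fun y => hzero _ (by rw [hsum]; exact not_lt.1 ht)
  calc ∫⁻ x, g x * ENNReal.ofReal (Real.exp (-∑ k, x k))
      = ∫⁻ y : Fin n → ℝ, ∫⁻ s : ℝ, g (Fin.snoc y s)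
          * ENNReal.ofReal (Real.exp (-∑ k, (Fin.snoc y s : Fin (n + 1) → ℝ) k)) := by
        rw [← (volume_preserving_piFinSuccAbove (fun _ : Fin (n + 1) => ℝ)
          (Fin.last n)).symm.lintegral_comp_emb (MeasurableEquiv.measurableEmbedding _),
          Measure.volume_eq_prod,
          lintegral_prod_symm' _ (by fun_prop)]
        simp only [MeasurableEquiv.piFinSuccAbove_symm_apply, Fin.insertNthEquiv, Equiv.coe_fn_mk,
          Fin.insertNth_last']
    _ = ∫⁻ y : Fin n → ℝ, ∫⁻ t : ℝ, g (Fin.snoc y (t - ∑ k, y k))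
          * ENNReal.ofReal (Real.exp (-t)) := by
        refine lintegral_congr fun y => ?_
        rw [← lintegral_sub_right_eq_self _ (∑ k, y k)]
        simp_rw [hsum]
    _ = ∫⁻ t : ℝ, ∫⁻ y : Fin n → ℝ, g (Fin.snoc y (t - ∑ k, y k))
          * ENNReal.ofReal (Real.exp (-t)) := by
        refine lintegral_lintegral_swap (Measurable.aemeasurable ?_)
        exact ((hg.comp hsnoc).comp measurable_swap).mul (by fun_prop)
    _ = ∫⁻ t : ℝ, (Set.Ioi (0 : ℝ)).indicator
          (fun t => ENNReal.ofReal (t ^ (d + n + 1 - 1) * Real.exp (-(1 * t)))) t * L := by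
        refine lintegral_congr fun t => ?_
        rw [lintegral_mul_const _
          (hslice t), hinner]
        by_cases ht : 0 < t
        · have : 0 ≤ t ^ (d + n) := by positivity
          simp only [Set.indicator, Set.mem_Ioi, ht, if_true, add_sub_cancel_right, one_mul,
            ENNReal.ofReal_mul this]
          ring
        · simp [Set.indicator, ht]
    _ = _ := by
        have hm : Measurable ((Set.Ioi (0 : ℝ)).indicator
          (fun t => ENNReal.ofReal (t ^ (d + n + 1 - 1) * Real.exp (-(1 * t))))) :=
          Measurable.indicator (by fun_prop) measurableSet_Ioi
        rw [lintegral_mul_const _ hm, lintegral_indicator measurableSet_Ioi,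
          lintegral_rpow_mul_exp hd one_pos]
        simp

/-- The open positive orthant. -/
def openOrthant (n : ℕ) : Set (Fin n → ℝ) := {x | ∀ k, 0 < x k}

theorem measurableSet_openOrthant (n : ℕ) : MeasurableSet (openOrthant n) := by
  have : openOrthant n = ⋂ k, {x | 0 < x k} := by ext; simp [openOrthant]
  rw [this]
  exact MeasurableSet.iInter fun k => measurableSet_lt measurable_const (measurable_pi_apply k)

theorem coordsOf_eq_snoc {n : ℕ} (y : Fin n → ℝ) :
    (coordsOf (K := n + 1) y : Fin (n + 1) → ℝ) = Fin.snoc y (1 - ∑ k, y k) := by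
  funext k
  induction k using Fin.lastCases with
  | last => simp [coordsOf]
  | cast k => simp [coordsOf]

theorem mem_simplexDomain_iff {n : ℕ} (y : Fin n → ℝ) :
    y ∈ simplexDomain (n + 1) ↔ coordsOf (K := n + 1) y ∈ openOrthant (n + 1) := by
  rw [coordsOf_eq_snoc]
  simp [simplexDomain, openOrthant, Fin.forall_fin_succ']

theorem measurable_coordsOf (n : ℕ) :
    Measurable (coordsOf : (Fin (n + 1 - 1) → ℝ) → Fin (n + 1) → ℝ) := by
  refine measurable_pi_iff.2 fun k => ?_
  unfold coordsOf
  split_ifs <;> fun_prop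

theorem measurableSet_simplexDomain (n : ℕ) : MeasurableSet (simplexDomain (n + 1)) := by
  have : simplexDomain (n + 1) = coordsOf ⁻¹' openOrthant (n + 1) :=
    Set.ext fun y => mem_simplexDomain_iff y
  rw [this]
  exact measurable_coordsOf n (measurableSet_openOrthant _)

theorem simplexIntegral_congr {n : ℕ} {f h : (Fin (n + 1) → ℝ) → ℝ}
    (hfh : ∀ x ∈ openOrthant (n + 1), f x = h x) :
    simplexIntegral (n + 1) f = simplexIntegral (n + 1) h :=
  setIntegral_congr_fun (measurableSet_simplexDomain n)
    fun y hy => hfh _ ((mem_simplexDomain_iff y).1 hy)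

theorem simplexIntegral_of_homogeneous {n : ℕ} {h : (Fin (n + 1) → ℝ) → ℝ} (hm : Measurable h)
    (hpos : ∀ x ∈ openOrthant (n + 1), 0 ≤ h x) {d : ℝ} (hd : 0 < d + n + 1)
    (hhom : ∀ t : ℝ, 0 < t → ∀ x ∈ openOrthant (n + 1), h (t • x) = t ^ d * h x) :
    simplexIntegral (n + 1) h
      = (∫⁻ x in openOrthant (n + 1),
          ENNReal.ofReal (h x * Real.exp (-∑ k, x k))).toReal / Real.Gamma (d + n + 1) := by
  have hP := measurableSet_openOrthant (n + 1)
  set g : (Fin (n + 1) → ℝ) → ℝ≥0∞ :=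
    (openOrthant (n + 1)).indicator fun x => ENNReal.ofReal (h x) with hg
  have hgm : Measurable g := Measurable.indicator (by fun_prop) hP
  have key := lintegral_homogeneous_mul_exp hgm hd
    (by
      intro t ht x
      have hiff : t • x ∈ openOrthant (n + 1) ↔ x ∈ openOrthant (n + 1) := by
        simp [openOrthant, ht]
      by_cases hx : x ∈ openOrthant (n + 1)
      · rw [hg, Set.indicator_of_mem (hiff.2 hx), Set.indicator_of_mem hx, hhom t ht x hx,
          ENNReal.ofReal_mul (by positivity)]
      · rw [hg, Set.indicator_of_notMem (fun h => hx (hiff.1 h)), Set.indicator_of_notMem hx,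
          mul_zero])
    (by
      intro x hx
      refine Set.indicator_of_notMem (fun hmem => ?_) _
      exact hx.not_gt (sum_pos (fun k _ => hmem k) univ_nonempty))
  have hleft : ∫⁻ x in openOrthant (n + 1), ENNReal.ofReal (h x * Real.exp (-∑ k, x k))
      = ∫⁻ x, g x * ENNReal.ofReal (Real.exp (-∑ k, x k)) := by
    rw [← lintegral_indicator hP]
    refine lintegral_congr fun x => ?_
    by_cases hx : x ∈ openOrthant (n + 1)
    · simp [hg, hx, ENNReal.ofReal_mul (hpos x hx)]
    · simp [hg, hx]
  have hright : simplexIntegral (n + 1) h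
      = (∫⁻ y : Fin n → ℝ, g (Fin.snoc y (1 - ∑ k, y k))).toReal := by
    rw [simplexIntegral, integral_eq_lintegral_of_nonneg_ae
      (ae_restrict_of_forall_mem (measurableSet_simplexDomain n)
        fun y hy => hpos _ ((mem_simplexDomain_iff y).1 hy))
      (hm.comp (measurable_coordsOf n)).aestronglyMeasurable,
      ← lintegral_indicator (measurableSet_simplexDomain n)]
    congr 1
    refine lintegral_congr fun y => ?_
    rw [← coordsOf_eq_snoc]
    have hiff := mem_simplexDomain_iff (n := n) y
    by_cases hy : y ∈ simplexDomain (n + 1)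
    · rw [Set.indicator_of_mem hy, hg, Set.indicator_of_mem (hiff.1 hy)]
    · rw [Set.indicator_of_notMem hy, hg, Set.indicator_of_notMem (fun h => hy (hiff.2 h))]
  have hG := Real.Gamma_pos_of_pos hd
  rw [hleft, key, hright, ENNReal.toReal_mul, ENNReal.toReal_ofReal hG.le,
    mul_div_cancel_left₀ _ hG.ne']

theorem measurable_dirDensity {n : ℕ} (α : Fin n → ℝ) : Measurable (dirDensity α) := by
  unfold dirDensity; fun_prop

theorem dirDensity_pos {n : ℕ} (α : Fin n → ℝ) {x : Fin n → ℝ} (hx : x ∈ openOrthant n) :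
    0 < dirDensity α x :=
  prod_pos fun k _ => Real.rpow_pos_of_pos (hx k) _

theorem dirDensity_smul {n : ℕ} (α : Fin n → ℝ) {x : Fin n → ℝ} (hx : x ∈ openOrthant n)
    {t : ℝ} (ht : 0 < t) :
    dirDensity α (t • x) = t ^ (∑ k, α k - n) * dirDensity α x := by
  have : ∑ k, α k - n = ∑ k, (α k - 1) := by simp
  rw [this, Real.rpow_sum_of_pos ht, dirDensity, dirDensity, ← prod_mul_distrib]
  refine prod_congr rfl fun k _ => ?_
  rw [Pi.smul_apply, smul_eq_mul, Real.mul_rpow ht.le (hx k).le]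

theorem dirDensity_add_single {n : ℕ} (α : Fin n → ℝ) {x : Fin n → ℝ} (hx : x ∈ openOrthant n)
    (i : Fin n) : dirDensity (α + Pi.single i 1) x = x i * dirDensity α x := by
  have h : x i = ∏ k, if k = i then x i else 1 := by simp
  rw [h, dirDensity, dirDensity, ← prod_mul_distrib]
  refine prod_congr rfl fun k _ => ?_
  by_cases hk : k = i
  · subst hk
    rw [if_pos rfl, Pi.add_apply, Pi.single_eq_same, add_sub_right_comm, Real.rpow_add (hx k),
      Real.rpow_one, mul_comm]
  · simp [hk]

theorem prod_Gamma_add_single {n : ℕ} {α : Fin n → ℝ} (hα : ∀ k, 0 < α k) (i : Fin n) :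
    ∏ k, Real.Gamma ((α + Pi.single i 1 : Fin n → ℝ) k) = α i * ∏ k, Real.Gamma (α k) := by
  have h : α i = ∏ k, if k = i then α i else 1 := by simp
  rw [h, ← prod_mul_distrib]
  refine prod_congr rfl fun k _ => ?_
  by_cases hk : k = i
  · subst hk
    rw [if_pos rfl, Pi.add_apply, Pi.single_eq_same, Real.Gamma_add_one (hα k).ne']
  · simp [hk]

theorem lintegral_dirDensity_mul_exp {n : ℕ} {β c : Fin n → ℝ} (hβ : ∀ k, 0 < β k)
    (hc : ∀ k, 0 < c k) :
    ∫⁻ x in openOrthant n, ENNReal.ofReal (dirDensity β x * Real.exp (-∑ k, c k * x k))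
      = ENNReal.ofReal ((∏ k, (1 / c k) ^ β k) * ∏ k, Real.Gamma (β k)) := by
  set φ : Fin n → ℝ → ℝ≥0∞ := fun k => (Set.Ioi (0 : ℝ)).indicator
    fun t => ENNReal.ofReal (t ^ (β k - 1) * Real.exp (-(c k * t))) with hφ
  have hφm : ∀ k, Measurable (φ k) := fun k =>
    Measurable.indicator (by fun_prop) measurableSet_Ioi
  have h : ∀ x, (openOrthant n).indicator
      (fun x => ENNReal.ofReal (dirDensity β x * Real.exp (-∑ k, c k * x k))) x
      = ∏ k, φ k (x k) := by
    intro x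
    by_cases hx : x ∈ openOrthant n
    · rw [Set.indicator_of_mem hx, ← sum_neg_distrib, Real.exp_sum, dirDensity,
        ← prod_mul_distrib, ENNReal.ofReal_prod_of_nonneg]
      · refine prod_congr rfl fun k _ => ?_
        simp only [hφ]
        rw [Set.indicator_of_mem (show x k ∈ Set.Ioi (0 : ℝ) from hx k)]
      · intro k _
        have := hx k
        positivity
    · rw [Set.indicator_of_notMem hx]
      obtain ⟨k, hk⟩ := not_forall.1 hx
      refine (prod_eq_zero (mem_univ k) ?_).symm
      rw [hφ]
      exact Set.indicator_of_notMem (show x k ∉ Set.Ioi (0 : ℝ) from hk) _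
  rw [← lintegral_indicator (measurableSet_openOrthant n), lintegral_congr h,
    lintegral_fin_prod_eq_prod hφm, ← prod_mul_distrib, ENNReal.ofReal_prod_of_nonneg]
  · refine prod_congr rfl fun k _ => ?_
    rw [hφ, lintegral_indicator measurableSet_Ioi, lintegral_rpow_mul_exp (hβ k) (hc k)]
  · intro k _
    have := hc k
    have := Real.Gamma_pos_of_pos (hβ k)
    positivity

theorem simplexIntegral_dirDensity {n : ℕ} {α : Fin (n + 1) → ℝ} (hα : ∀ k, 0 < α k) :
    simplexIntegral (n + 1) (fun θ => dirDensity α θ)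
      = (∏ k, Real.Gamma (α k)) / Real.Gamma (∑ k, α k) := by
  have h0 : 0 < ∑ k, α k := sum_pos (fun k _ => hα k) univ_nonempty
  have hd : ∑ k, α k - ((n + 1 : ℕ) : ℝ) + n + 1 = ∑ k, α k := by push_cast; ring
  have hI := lintegral_dirDensity_mul_exp hα (c := fun _ => 1) fun _ => one_pos
  simp only [one_mul, div_one, Real.one_rpow, prod_const_one] at hI
  rw [simplexIntegral_of_homogeneous (measurable_dirDensity α)
    (fun x hx => (dirDensity_pos α hx).le) (by rwa [hd])
    (fun t ht x hx => dirDensity_smul α hx ht), hd, hI, ENNReal.toReal_ofReal]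
  exact prod_nonneg fun k _ => (Real.Gamma_pos_of_pos (hα k)).le

theorem lintegral_exp_neg_mul {s : ℝ} (hs : 0 < s) :
    ∫⁻ u in Set.Ioi (0 : ℝ), ENNReal.ofReal (Real.exp (-(s * u))) = ENNReal.ofReal s⁻¹ := by
  simpa using lintegral_rpow_mul_exp one_pos hs

theorem lintegral_dirDensity_div_add_mul_exp {n : ℕ} {β : Fin n → ℝ} (hβ : ∀ k, 0 < β k)
    {i j : Fin n} (hij : i ≠ j) (hb : 1 < β i + β j) :
    ∫⁻ x in openOrthant n,
        ENNReal.ofReal (dirDensity β x * (x i + x j)⁻¹ * Real.exp (-∑ k, x k))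
      = ENNReal.ofReal ((∏ k, Real.Gamma (β k)) / (β i + β j - 1)) := by
  set c : ℝ → Fin n → ℝ := fun u k => 1 + u * ((if k = i then 1 else 0) + if k = j then 1 else 0) with hc
  have hcpos : ∀ u, 0 < u → ∀ k, 0 < c u k := by
    intro u hu k
    simp only [hc]
    split_ifs <;> linarith
  have hcsum : ∀ u (x : Fin n → ℝ), ∑ k, c u k * x k = ∑ k, x k + (x i + x j) * u := by
    intro u x
    simp only [hc, add_mul, one_mul, mul_add, sum_add_distrib, mul_ite, mul_one,
      mul_zero, ite_mul, zero_mul, sum_ite_eq', mem_univ, if_true]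
    ring
  have hcprod : ∀ u, 0 < u → ∏ k, (1 / c u k) ^ β k = (1 / (1 + u)) ^ (β i + β j) := by
    intro u hu
    have h : ∀ k, (1 / c u k) ^ β k
        = (if k = i then (1 / (1 + u)) ^ β i else 1)
          * (if k = j then (1 / (1 + u)) ^ β j else 1) := by
      intro k
      by_cases hki : k = i
      · subst hki; simp [hc, hij]
      · by_cases hkj : k = j
        · subst hkj; simp [hc, hki]
        · simp [hc, hki, hkj]
    rw [prod_congr rfl fun k _ => h k, prod_mul_distrib, Real.rpow_add (by positivity)]
    simp
  have hΓ : 0 ≤ ∏ k, Real.Gamma (β k) :=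
    prod_nonneg fun k _ => (Real.Gamma_pos_of_pos (hβ k)).le
  calc ∫⁻ x in openOrthant n,
        ENNReal.ofReal (dirDensity β x * (x i + x j)⁻¹ * Real.exp (-∑ k, x k))
      = ∫⁻ x in openOrthant n, ∫⁻ u in Set.Ioi (0 : ℝ),
          ENNReal.ofReal (dirDensity β x * Real.exp (-∑ k, c u k * x k)) := by
        refine setLIntegral_congr_fun (measurableSet_openOrthant n) fun x hx => ?_
        have hD := (dirDensity_pos β hx).le
        have hs : 0 < x i + x j := add_pos (hx i) (hx j)
        have h : ∀ u, ENNReal.ofReal (dirDensity β x * Real.exp (-∑ k, c u k * x k))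
            = ENNReal.ofReal (dirDensity β x * Real.exp (-∑ k, x k))
              * ENNReal.ofReal (Real.exp (-((x i + x j) * u))) := by
          intro u
          rw [← ENNReal.ofReal_mul (by positivity), hcsum, neg_add, Real.exp_add, mul_assoc]
        simp_rw [h]
        rw [lintegral_const_mul _ (by fun_prop), lintegral_exp_neg_mul hs,
          ← ENNReal.ofReal_mul (by positivity)]
        congr 1
        ring
    _ = ∫⁻ u in Set.Ioi (0 : ℝ), ∫⁻ x in openOrthant n,
          ENNReal.ofReal (dirDensity β x * Real.exp (-∑ k, c u k * x k)) := by
        refine lintegral_lintegral_swap (Measurable.aemeasurable ?_)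
        have := measurable_dirDensity β
        simp only [hc, Function.uncurry_def]
        fun_prop
    _ = ∫⁻ u in Set.Ioi (0 : ℝ), ENNReal.ofReal (∏ k, Real.Gamma (β k))
          * ENNReal.ofReal ((1 / (1 + u)) ^ (β i + β j)) := by
        refine setLIntegral_congr_fun measurableSet_Ioi fun u (hu : 0 < u) => ?_
        rw [lintegral_dirDensity_mul_exp hβ (hcpos u hu), hcprod u hu, mul_comm,
          ENNReal.ofReal_mul hΓ]
    _ = _ := by
        rw [lintegral_const_mul _ (by fun_prop), lintegral_one_add_rpow hb,
          ← ENNReal.ofReal_mul hΓ, mul_one_div]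

theorem simplexIntegral_dirDensity_div_add {n : ℕ} {β : Fin (n + 1) → ℝ} (hβ : ∀ k, 0 < β k)
    {i j : Fin (n + 1)} (hij : i ≠ j) (hb : 1 < β i + β j) :
    simplexIntegral (n + 1) (fun θ => dirDensity β θ * (θ i + θ j)⁻¹)
      = (∏ k, Real.Gamma (β k)) / (β i + β j - 1) / Real.Gamma (∑ k, β k - 1) := by
  have h1 : 1 < ∑ k, β k := by
    refine hb.trans_le ?_
    rw [← sum_pair hij]
    exact sum_le_sum_of_subset_of_nonneg (subset_univ _) fun k _ _ => (hβ k).le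
  have hd : ∑ k, β k - ((n + 1 : ℕ) : ℝ) - 1 + n + 1 = ∑ k, β k - 1 := by push_cast; ring
  have hm := measurable_dirDensity β
  rw [simplexIntegral_of_homogeneous (d := ∑ k, β k - ((n + 1 : ℕ) : ℝ) - 1) (by fun_prop)
    (fun x hx => by
      have := dirDensity_pos β hx
      have := hx i
      have := hx j
      positivity) (by rw [hd]; linarith)
    (fun t ht x hx => by
      rw [dirDensity_smul β hx ht, Pi.smul_apply, Pi.smul_apply, smul_eq_mul, smul_eq_mul,
        ← mul_add, mul_inv, Real.rpow_sub_one ht.ne']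
      ring), hd, lintegral_dirDensity_div_add_mul_exp hβ hij hb, ENNReal.toReal_ofReal]
  exact div_nonneg (prod_nonneg fun k _ => (Real.Gamma_pos_of_pos (hβ k)).le) (by linarith)

theorem simplexIntegral_moment {n : ℕ} {α : Fin (n + 1) → ℝ} (hα : ∀ k, 0 < α k)
    {i j : Fin (n + 1)} (hij : i ≠ j) (m : Fin (n + 1)) {β : Fin (n + 1) → ℝ}
    (hβ : β = α + Pi.single i 1 + Pi.single m 1) :
    simplexIntegral (n + 1) (fun θ => θ m * (θ i / (θ i + θ j)) * dirDensity α θ)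
      = (α + Pi.single i 1 : Fin (n + 1) → ℝ) m * α i / ((∑ k, α k) * (β i + β j - 1))
        * simplexIntegral (n + 1) (fun θ => dirDensity α θ) := by
  have hsingle : ∀ l k : Fin (n + 1), (0 : ℝ) ≤ (Pi.single l 1 : Fin (n + 1) → ℝ) k := by
    intro l k
    rw [Pi.single_apply]; split_ifs <;> norm_num
  have hα' : ∀ k, 0 < (α + Pi.single i 1 : Fin (n + 1) → ℝ) k := fun k =>
    add_pos_of_pos_of_nonneg (hα k) (hsingle i k)
  have hβpos : ∀ k, 0 < β k := fun k => by
    rw [hβ]; exact add_pos_of_pos_of_nonneg (hα' k) (hsingle m k)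
  have hb : 1 < β i + β j := by
    have hi : β i = α i + 1 + (Pi.single m 1 : Fin (n + 1) → ℝ) i := by simp [hβ]
    linarith [hα i, hsingle m i, hβpos j]
  have hsum : ∑ k, β k - 1 = ∑ k, α k + 1 := by
    simp [hβ, sum_add_distrib]
  have h0 : 0 < ∑ k, α k := sum_pos (fun k _ => hα k) univ_nonempty
  have hG := Real.Gamma_pos_of_pos h0
  rw [simplexIntegral_congr (h := fun θ => dirDensity β θ * (θ i + θ j)⁻¹)
    (fun x hx => by
      rw [hβ, dirDensity_add_single _ hx, dirDensity_add_single _ hx]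
      ring), simplexIntegral_dirDensity_div_add hβpos hij hb, hsum,
    simplexIntegral_dirDensity hα, Real.Gamma_add_one h0.ne']
  have hprod : ∏ k, Real.Gamma (β k)
      = (α + Pi.single i 1 : Fin (n + 1) → ℝ) m * (α i * ∏ k, Real.Gamma (α k)) := by
    rw [hβ, prod_Gamma_add_single hα', prod_Gamma_add_single hα]
  have hb' : β i + β j - 1 ≠ 0 := by linarith
  rw [hprod]
  field_simp

/-- Posterior first moments after one Bradley–Terry–Luce comparison where `i`
beats `j`, under a Dirichlet(α) prior. -/
theorem dirichlet_posterior_first_moments (K : ℕ) (hK : 2 ≤ K) (α : Fin K → ℝ)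
    (hα : ∀ k, 0 < α k) (i j : Fin K) (hij : i ≠ j) :
    (simplexIntegral K (fun θ => θ i * (θ i / (θ i + θ j)) * dirDensity α θ)
      = (α i * (α i + 1) / ((∑ k, α k) * (α i + α j + 1)))
        * simplexIntegral K (fun θ => dirDensity α θ)) ∧
    (simplexIntegral K (fun θ => θ j * (θ i / (θ i + θ j)) * dirDensity α θ)
      = (α i * α j / ((∑ k, α k) * (α i + α j + 1)))
        * simplexIntegral K (fun θ => dirDensity α θ)) ∧
    (∀ k : Fin K, k ≠ i → k ≠ j →
      simplexIntegral K (fun θ => θ k * (θ i / (θ i + θ j)) * dirDensity α θ)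
        = (α k * α i / ((∑ k', α k') * (α i + α j)))
          * simplexIntegral K (fun θ => dirDensity α θ)) := by
  obtain ⟨n, rfl⟩ : ∃ n, K = n + 1 := ⟨K - 1, by omega⟩
  refine ⟨?_, ?_, fun k hki hkj => ?_⟩
  · rw [simplexIntegral_moment hα hij i rfl]
    congr 2
    · simp; ring
    · simp [hij.symm]; left; ring
  · rw [simplexIntegral_moment hα hij j rfl]
    congr 2
    · simp [hij.symm]; ring
    · simp [hij, hij.symm]; left; ring
  · rw [simplexIntegral_moment hα hij k rfl]
    congr 2
    · simp [hki]
    · simp [hki.symm, hkj.symm, hij.symm]; left; ring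
end

section
/- Let K ≥ 2, let α ∈ ℝ^K with α_k > 0 for all k, let μ, ν > 0, and let i ≠ j be indices in {1,…,K}. Then ∫_0^1 ∫_Δ L_{ij}(θ,ρ) · D_α(θ) · W_{μ,ν}(ρ) dθ dρ = [(μ α_i + ν α_j) / ((μ+ν)(α_i+α_j))] · (∫_Δ D_α(θ) dθ) · (∫_0^1 W_{μ,ν}(ρ) dρ). -/
open MeasureTheory Finset

/-- The unnormalized Beta density `W_{μ,ν}(ρ) = ρ^(μ-1) (1-ρ)^(ν-1)`. -/
noncomputable def betaDensity (μ ν ρ : ℝ) : ℝ :=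
  ρ ^ (μ - 1) * (1 - ρ) ^ (ν - 1)

/-- `L_{ij}(θ,ρ) = ρ θ_i/(θ_i+θ_j) + (1-ρ) θ_j/(θ_i+θ_j)`, the probability that
a worker of reliability `ρ` prefers item `i` to item `j`. -/
noncomputable def likeL {K : ℕ} (i j : Fin K) (θ : Fin K → ℝ) (ρ : ℝ) : ℝ :=
  ρ * (θ i / (θ i + θ j)) + (1 - ρ) * (θ j / (θ i + θ j))

/-- `∫_0^1 ∫_Δ f(θ,ρ) dθ dρ`, the double integral over the simplex (via the
standard parametrization) and the unit interval. -/
noncomputable def dblIntegral (K : ℕ) (f : (Fin K → ℝ) → ℝ → ℝ) : ℝ :=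
  ∫ ρ in Set.Ioo (0:ℝ) 1, ∫ y in simplexDomain K, f (coordsOf y) ρ

/-! ### Beta integrals -/

lemma integral_betaDensity {a b : ℝ} (ha : 0 < a) (hb : 0 < b) :
    ∫ x in Set.Ioo (0:ℝ) 1, betaDensity a b x = ProbabilityTheory.beta a b := by
  have hB := ProbabilityTheory.beta_pos ha hb
  have h1 := ProbabilityTheory.lintegral_betaPDF_eq_one ha hb
  rw [ProbabilityTheory.lintegral_betaPDF, ← ENNReal.toReal_eq_one_iff,
    ← integral_eq_lintegral_of_nonneg_ae] at h1
  · simp_rw [mul_assoc, integral_const_mul] at h1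
    unfold betaDensity
    field_simp at h1
    linarith
  · refine ae_restrict_of_forall_mem measurableSet_Ioo fun x hx ↦ ?_
    have h0 := hx.1
    have h2 : 0 < 1 - x := sub_pos.2 hx.2
    simp only [Pi.zero_apply]
    positivity
  · exact Measurable.aestronglyMeasurable (by fun_prop)

lemma integrableOn_betaDensity {a b : ℝ} (ha : 0 < a) (hb : 0 < b) :
    IntegrableOn (betaDensity a b) (Set.Ioo (0:ℝ) 1) := by
  by_contra h
  have h1 := integral_betaDensity ha hb
  rw [integral_undef h] at h1
  exact (ProbabilityTheory.beta_pos ha hb).ne h1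

lemma mul_betaDensity (a b : ℝ) {x : ℝ} (hx : 0 < x) :
    x * betaDensity a b x = betaDensity (a + 1) b x := by
  unfold betaDensity
  rw [show a + 1 - 1 = (a - 1) + 1 by ring, Real.rpow_add_one hx.ne']
  ring

lemma integrableOn_mul_betaDensity {a b : ℝ} (ha : 0 < a) (hb : 0 < b) :
    IntegrableOn (fun x ↦ x * betaDensity a b x) (Set.Ioo (0:ℝ) 1) :=
  (integrableOn_betaDensity (a := a + 1) (by positivity) hb).congr_fun
    (fun _ hx ↦ (mul_betaDensity a b hx.1).symm) measurableSet_Ioo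

/-- The mean of a Beta density. -/
lemma integral_mul_betaDensity {a b : ℝ} (ha : 0 < a) (hb : 0 < b) :
    ∫ x in Set.Ioo (0:ℝ) 1, x * betaDensity a b x
      = a / (a + b) * ∫ x in Set.Ioo (0:ℝ) 1, betaDensity a b x := by
  rw [setIntegral_congr_fun measurableSet_Ioo fun x hx ↦ mul_betaDensity a b hx.1,
    integral_betaDensity (by positivity) hb, integral_betaDensity ha hb]
  unfold ProbabilityTheory.beta
  have hab := Real.Gamma_pos_of_pos (add_pos ha hb)
  rw [show a + 1 + b = (a + b) + 1 by ring, Real.Gamma_add_one ha.ne',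
    Real.Gamma_add_one (add_pos ha hb).ne']
  field_simp

lemma integral_Ioo_scaled_betaDensity (a b : ℝ) {s : ℝ} (hs : 0 < s) (g : ℝ → ℝ) :
    ∫ t in Set.Ioo 0 s, g (t / s) * (t ^ (a - 1) * (s - t) ^ (b - 1))
      = s * (s ^ (a - 1) * s ^ (b - 1)) * ∫ x in Set.Ioo (0:ℝ) 1, g x * betaDensity a b x := by
  rw [← integral_indicator measurableSet_Ioo, ← integral_indicator measurableSet_Ioo]
  have h := Measure.integral_comp_mul_left
    ((Set.Ioo 0 s).indicator fun t ↦ g (t / s) * (t ^ (a - 1) * (s - t) ^ (b - 1))) s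
  rw [abs_of_pos (inv_pos.2 hs), smul_eq_mul, eq_inv_mul_iff_mul_eq₀ hs.ne'] at h
  rw [← h, mul_assoc]
  congr 1
  rw [← integral_const_mul]
  refine integral_congr_ae (Filter.Eventually.of_forall fun x ↦ ?_)
  simp only
  have hmem : s * x ∈ Set.Ioo 0 s ↔ x ∈ Set.Ioo (0:ℝ) 1 := by
    simp [Set.mem_Ioo, hs, mul_lt_iff_lt_one_right hs]
  by_cases hx : x ∈ Set.Ioo (0:ℝ) 1
  · rw [Set.indicator_of_mem (hmem.2 hx), Set.indicator_of_mem hx,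
      Real.mul_rpow hs.le hx.1.le, show s - s * x = s * (1 - x) by ring,
      Real.mul_rpow hs.le (sub_pos.2 hx.2).le, mul_div_cancel_left₀ _ hs.ne', betaDensity]
    ring
  · rw [Set.indicator_of_notMem (hmem.not.2 hx), Set.indicator_of_notMem hx, mul_zero]

lemma integral_Ioo_mean (a b : ℝ) (ha : 0 < a) (hb : 0 < b) {s : ℝ} (hs : 0 < s) :
    ∫ t in Set.Ioo 0 s, t / s * (t ^ (a - 1) * (s - t) ^ (b - 1))
      = a / (a + b) * ∫ t in Set.Ioo 0 s, t ^ (a - 1) * (s - t) ^ (b - 1) := by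
  have h1 := integral_Ioo_scaled_betaDensity a b hs fun x ↦ x
  have h2 := integral_Ioo_scaled_betaDensity a b hs fun _ ↦ 1
  simp only [one_mul] at h2
  rw [h1, h2, integral_mul_betaDensity ha hb]
  ring

/-! ### Coordinates on the simplex -/

section Simplex

variable {m : ℕ}

/-- `simplexDomain` for `m + 2` coordinates, with its index type in normal form. -/
def simplexSet (m : ℕ) : Set (Fin (m + 1) → ℝ) := simplexDomain (m + 2)

/-- `coordsOf` for `m + 2` coordinates, with its index type in normal form. -/
noncomputable def simplexPoint (y : Fin (m + 1) → ℝ) : Fin (m + 2) → ℝ :=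
  coordsOf (K := m + 2) y

lemma simplexPoint_castSucc (y : Fin (m + 1) → ℝ) (k : Fin (m + 1)) :
    simplexPoint y k.castSucc = y k := by
  simp only [simplexPoint, coordsOf, Fin.val_castSucc]
  exact dif_pos k.isLt

lemma simplexPoint_last (y : Fin (m + 1) → ℝ) :
    simplexPoint y (Fin.last (m + 1)) = 1 - ∑ k, y k := by
  simp only [simplexPoint, coordsOf, Fin.val_last]
  exact dif_neg (lt_irrefl _)

lemma simplexPoint_pos {y : Fin (m + 1) → ℝ} (hy : y ∈ simplexSet m) (k : Fin (m + 2)) :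
    0 < simplexPoint y k := by
  induction k using Fin.lastCases with
  | last => rw [simplexPoint_last]; exact sub_pos.2 hy.2
  | cast k => rw [simplexPoint_castSucc]; exact hy.1 k

lemma mem_simplexSet_iff {y : Fin (m + 1) → ℝ} :
    y ∈ simplexSet m ↔ ∀ k, 0 < simplexPoint y k := by
  refine ⟨simplexPoint_pos, fun h ↦ ⟨fun k ↦ ?_, ?_⟩⟩
  · simpa [simplexPoint_castSucc] using h k.castSucc
  · simpa [simplexPoint_last] using h (Fin.last _)

lemma measurable_simplexPoint (k : Fin (m + 2)) :
    Measurable fun y : Fin (m + 1) → ℝ ↦ simplexPoint y k := by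
  induction k using Fin.lastCases with
  | last => simp only [simplexPoint_last]; fun_prop
  | cast k => simp only [simplexPoint_castSucc]; fun_prop

lemma measurableSet_simplexSet :
    MeasurableSet (simplexSet m) := by
  have : (simplexSet m)
      = ⋂ k, {y | 0 < simplexPoint y k} := by
    ext y
    rw [mem_simplexSet_iff, Set.mem_iInter]
    rfl
  rw [this]
  exact MeasurableSet.iInter fun k ↦ measurableSet_lt measurable_const (measurable_simplexPoint k)

/-- Exchange the coordinate `p` with the last, dependent, coordinate of the simplex. -/
def reflectCoord (p : Fin (m + 1)) (y : Fin (m + 1) → ℝ) : Fin (m + 1) → ℝ :=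
  Function.update y p (1 - ∑ k, y k)

lemma simplexPoint_reflectCoord (p : Fin (m + 1)) (y : Fin (m + 1) → ℝ) (k : Fin (m + 2)) :
    simplexPoint (reflectCoord p y) k
      = simplexPoint y (Equiv.swap p.castSucc (Fin.last _) k) := by
  induction k using Fin.lastCases with
  | last =>
    rw [simplexPoint_last, Equiv.swap_apply_right, simplexPoint_castSucc, reflectCoord,
      Finset.sum_update_of_mem (mem_univ p), ← Finset.add_sum_erase _ _ (mem_univ p),
      Finset.sdiff_singleton_eq_erase]
    ring
  | cast k =>
    rw [simplexPoint_castSucc, reflectCoord]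
    rcases eq_or_ne k p with rfl | h
    · rw [Equiv.swap_apply_left, simplexPoint_last, Function.update_self]
    · rw [Equiv.swap_apply_of_ne_of_ne (by simpa using h) (Fin.castSucc_lt_last k).ne,
        simplexPoint_castSucc, Function.update_of_ne h]

lemma reflectCoord_involutive (p : Fin (m + 1)) :
    Function.Involutive (reflectCoord p) := by
  intro y
  ext k
  rw [← simplexPoint_castSucc (reflectCoord p _), simplexPoint_reflectCoord,
    simplexPoint_reflectCoord, Equiv.swap_apply_self,
    simplexPoint_castSucc]

lemma measurePreserving_reflectCoord (p : Fin (m + 1)) :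
    MeasurePreserving (reflectCoord p) := by
  have he := volume_preserving_piFinSuccAbove (fun _ : Fin (m + 1) ↦ ℝ) p
  have hskew : MeasurePreserving
      (fun q : (Fin m → ℝ) × ℝ ↦ (q.1, (1 - ∑ k, q.1 k) - q.2)) := by
    refine (MeasurePreserving.id volume).skew_product
      (g := fun (z : Fin m → ℝ) (t : ℝ) ↦ (1 - ∑ k, z k) - t) (by fun_prop) ?_
    exact Filter.Eventually.of_forall fun z ↦
      (volume.measurePreserving_sub_left (1 - ∑ k, z k)).map_eq
  have h := (he.symm _).comp ((Measure.measurePreserving_swap.comp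
    (hskew.comp Measure.measurePreserving_swap)).comp he)
  convert h using 1
  ext y k
  change _ = p.insertNth (α := fun _ ↦ ℝ) (1 - ∑ l, y (p.succAbove l) - y p)
    (fun l ↦ y (p.succAbove l)) k
  rw [reflectCoord, Fin.sum_univ_succAbove y p]
  rcases eq_or_ne k p with rfl | hk
  · rw [Function.update_self, Fin.insertNth_apply_same]
    ring
  · obtain ⟨l, rfl⟩ := Fin.exists_succAbove_eq hk
    rw [Function.update_of_ne hk, Fin.insertNth_apply_succAbove]

lemma reflectCoord_preimage_simplexSet (p : Fin (m + 1)) :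
    reflectCoord p ⁻¹' simplexSet m = simplexSet m := by
  ext y
  rw [Set.mem_preimage, mem_simplexSet_iff (y := reflectCoord p y),
    mem_simplexSet_iff (y := y)]
  simp only [simplexPoint_reflectCoord]
  exact (Equiv.swap p.castSucc (Fin.last _)).forall_congr_right
    (q := fun k ↦ 0 < simplexPoint y k)

lemma measurableEmbedding_reflectCoord (p : Fin (m + 1)) :
    MeasurableEmbedding (reflectCoord p) :=
  (MeasurableEquiv.ofInvolutive _ (reflectCoord_involutive p)
    (measurePreserving_reflectCoord p).measurable).measurableEmbedding

lemma setIntegral_reflectCoord (p : Fin (m + 1)) (f : (Fin (m + 1) → ℝ) → ℝ) :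
    ∫ y in simplexSet m, f (reflectCoord p y) = ∫ y in simplexSet m, f y := by
  have h := (measurePreserving_reflectCoord p).setIntegral_preimage_emb
    (measurableEmbedding_reflectCoord p) f (simplexSet m)
  rwa [reflectCoord_preimage_simplexSet] at h

lemma integrableOn_comp_reflectCoord (p : Fin (m + 1)) {f : (Fin (m + 1) → ℝ) → ℝ} :
    IntegrableOn (fun y ↦ f (reflectCoord p y)) (simplexSet m)
      ↔ IntegrableOn f (simplexSet m) := by
  have h := (measurePreserving_reflectCoord p).integrableOn_comp_preimage
    (measurableEmbedding_reflectCoord p) (f := f) (s := simplexSet m)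
  rwa [reflectCoord_preimage_simplexSet] at h

lemma dirDensity_simplexPoint_reflectCoord (p : Fin (m + 1)) (α : Fin (m + 2) → ℝ)
    (y : Fin (m + 1) → ℝ) :
    dirDensity α (simplexPoint (reflectCoord p y))
      = dirDensity (α ∘ Equiv.swap p.castSucc (Fin.last _)) (simplexPoint y) := by
  unfold dirDensity
  simp only [simplexPoint_reflectCoord]
  refine Fintype.prod_equiv (Equiv.swap p.castSucc (Fin.last _)) _ _ fun k ↦ ?_
  simp

/-! ### Pairwise shares under the Dirichlet density -/

lemma integrableOn_share_mul {i j : Fin (m + 2)} {f : (Fin (m + 1) → ℝ) → ℝ}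
    (hf : IntegrableOn f (simplexSet m)) :
    IntegrableOn (fun y ↦ simplexPoint y i / (simplexPoint y i + simplexPoint y j) * f y)
      (simplexSet m) := by
  refine Integrable.bdd_mul (c := 1) hf ?_ ?_
  · exact ((measurable_simplexPoint i).div
      ((measurable_simplexPoint i).add (measurable_simplexPoint j))).aestronglyMeasurable
  · refine ae_restrict_of_forall_mem measurableSet_simplexSet fun y hy ↦ ?_
    have hi := simplexPoint_pos hy i
    have hj := simplexPoint_pos hy j
    rw [Real.norm_of_nonneg (by positivity), div_le_one (by positivity)]
    linarith

lemma setIntegral_simplexSet_eq (p : Fin (m + 1)) {f : (Fin (m + 1) → ℝ) → ℝ}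
    (hf : IntegrableOn f (simplexSet m)) :
    ∫ y in simplexSet m, f y
      = ∫ z : Fin m → ℝ, ∫ t : ℝ,
          (simplexSet m).indicator f (p.insertNth (α := fun _ ↦ ℝ) t z) := by
  have he := (volume_preserving_piFinSuccAbove (fun _ : Fin (m + 1) ↦ ℝ) p).symm
  rw [← integral_indicator measurableSet_simplexSet, ← he.integral_comp', Measure.volume_eq_prod,
    integral_prod_symm]
  · rfl
  · rw [← Measure.volume_eq_prod]
    exact (he.integrable_comp_emb (MeasurableEquiv.measurableEmbedding _)).2
      (hf.integrable_indicator measurableSet_simplexSet)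

lemma insertNth_mem_simplexSet {p : Fin (m + 1)} {t : ℝ} {z : Fin m → ℝ} :
    p.insertNth (α := fun _ ↦ ℝ) t z ∈ simplexSet m
      ↔ (∀ k, 0 < z k) ∧ t ∈ Set.Ioo 0 (1 - ∑ k, z k) := by
  change (∀ k : Fin (m + 1), 0 < p.insertNth (α := fun _ ↦ ℝ) t z k)
    ∧ ∑ k : Fin (m + 1), p.insertNth (α := fun _ ↦ ℝ) t z k < 1 ↔ _
  rw [Fin.sum_univ_succAbove _ p, p.forall_iff_succAbove]
  simp only [Fin.insertNth_apply_same, Fin.insertNth_apply_succAbove]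
  constructor
  · rintro ⟨⟨h1, h2⟩, h3⟩; exact ⟨h2, h1, by linarith⟩
  · rintro ⟨h1, h2, h3⟩; exact ⟨⟨h2, h1⟩, by linarith⟩

lemma integral_share_last (α : Fin (m + 2) → ℝ) (hα : ∀ k, 0 < α k) (p : Fin (m + 1))
    (hD : IntegrableOn (fun y ↦ dirDensity α (simplexPoint y)) (simplexSet m)) :
    ∫ y in simplexSet m,
        simplexPoint y p.castSucc / (simplexPoint y p.castSucc + simplexPoint y (Fin.last _))
          * dirDensity α (simplexPoint y)
      = α p.castSucc / (α p.castSucc + α (Fin.last _))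
        * ∫ y in simplexSet m, dirDensity α (simplexPoint y) := by
  rw [setIntegral_simplexSet_eq p hD, setIntegral_simplexSet_eq p
    (integrableOn_share_mul hD), ← integral_const_mul]
  congr 1
  ext z
  set s := 1 - ∑ k, z k with hs
  by_cases hz : (∀ k, 0 < z k) ∧ 0 < s
  · obtain ⟨hz, hs0⟩ := hz
    have key (f : (Fin (m + 1) → ℝ) → ℝ) :
        ∫ t : ℝ, (simplexSet m).indicator f (p.insertNth (α := fun _ ↦ ℝ) t z)
          = ∫ t in Set.Ioo 0 s, f (p.insertNth (α := fun _ ↦ ℝ) t z) := by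
      rw [← integral_indicator measurableSet_Ioo]
      congr 1
      ext t
      simp only [Set.indicator, insertNth_mem_simplexSet, hz, implies_true, true_and, hs]
    have hlast (t : ℝ) : simplexPoint (p.insertNth (α := fun _ ↦ ℝ) t z) (Fin.last _)
        = s - t := by
      rw [simplexPoint_last, Fin.sum_univ_succAbove _ p]
      simp only [Fin.insertNth_apply_same, Fin.insertNth_apply_succAbove, hs]
      ring
    have hp (t : ℝ) : simplexPoint (p.insertNth (α := fun _ ↦ ℝ) t z) p.castSucc
        = t := by
      rw [simplexPoint_castSucc, Fin.insertNth_apply_same]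
    have hdir (t : ℝ) :
        dirDensity α (simplexPoint (p.insertNth (α := fun _ ↦ ℝ) t z))
          = (∏ k, z k ^ (α (p.succAbove k).castSucc - 1))
            * (t ^ (α p.castSucc - 1) * (s - t) ^ (α (Fin.last _) - 1)) := by
      rw [dirDensity, Fin.prod_univ_castSucc, Fin.prod_univ_succAbove _ p, hlast, hp]
      simp only [simplexPoint_castSucc, Fin.insertNth_apply_succAbove]
      ring
    rw [key, key]
    simp only [hdir, hlast, hp, add_sub_cancel, mul_left_comm _ (∏ k, _)]
    rw [integral_const_mul, integral_const_mul, integral_Ioo_mean _ _ (hα _) (hα _) hs0]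
    ring
  · have hnot (t : ℝ) : p.insertNth (α := fun _ ↦ ℝ) t z ∉ simplexSet m := by
      rw [insertNth_mem_simplexSet]
      exact fun h ↦ hz ⟨h.1, h.2.1.trans h.2.2⟩
    simp [Set.indicator_of_notMem (hnot _)]

lemma integral_share_add_integral_share {i j : Fin (m + 2)} {f : (Fin (m + 1) → ℝ) → ℝ}
    (hf : IntegrableOn f (simplexSet m)) :
    (∫ y in simplexSet m, simplexPoint y i / (simplexPoint y i + simplexPoint y j) * f y)
        + ∫ y in simplexSet m, simplexPoint y j / (simplexPoint y j + simplexPoint y i) * f y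
      = ∫ y in simplexSet m, f y := by
  rw [← integral_add (integrableOn_share_mul hf) (integrableOn_share_mul hf)]
  refine setIntegral_congr_fun measurableSet_simplexSet fun y hy ↦ ?_
  have hi := simplexPoint_pos hy i
  have hj := simplexPoint_pos hy j
  field_simp
  ring

lemma integral_share (α : Fin (m + 2) → ℝ) (hα : ∀ k, 0 < α k) {i j : Fin (m + 2)} (hij : i ≠ j)
    (hD : IntegrableOn (fun y ↦ dirDensity α (simplexPoint y)) (simplexSet m)) :
    ∫ y in simplexSet m,
        simplexPoint y i / (simplexPoint y i + simplexPoint y j) * dirDensity α (simplexPoint y)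
      = α i / (α i + α j) * ∫ y in simplexSet m, dirDensity α (simplexPoint y) := by
  induction j using Fin.lastCases with
  | last =>
    obtain ⟨p, rfl⟩ := Fin.exists_castSucc_eq.2 hij
    exact integral_share_last α hα p hD
  | cast q =>
    induction i using Fin.lastCases with
    | last =>
      have h1 := integral_share_add_integral_share (i := Fin.last _) (j := q.castSucc) hD
      rw [integral_share_last α hα q hD] at h1
      rw [eq_sub_of_add_eq h1]
      have := hα (Fin.last _)
      have := hα q.castSucc
      field_simp
      ring
    | cast p =>
      have hpq : Equiv.swap q.castSucc (Fin.last _) p.castSucc = p.castSucc :=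
        Equiv.swap_apply_of_ne_of_ne hij (Fin.castSucc_lt_last p).ne
      have h := integral_share_last (α ∘ Equiv.swap q.castSucc (Fin.last _)) (fun k ↦ hα _) p
        (by simpa only [dirDensity_simplexPoint_reflectCoord] using
          (integrableOn_comp_reflectCoord q).2 hD)
      rw [← setIntegral_reflectCoord q, ← setIntegral_reflectCoord q (fun y ↦ dirDensity α _)]
      simpa only [dirDensity_simplexPoint_reflectCoord, simplexPoint_reflectCoord, hpq,
        Equiv.swap_apply_left, Equiv.swap_apply_right, Function.comp_apply] using h

/-- On the simplex `L_{ij}` is bounded below by a positive constant, so that multiplying by it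
does not create integrability. -/
lemma integrableOn_of_likeL_mul {i j : Fin (m + 2)} {ρ : ℝ} (hρ : ρ ∈ Set.Ioo (0:ℝ) 1)
    {f : (Fin (m + 1) → ℝ) → ℝ}
    (hf : IntegrableOn (fun y ↦ likeL i j (simplexPoint y) ρ * f y) (simplexSet m)) :
    IntegrableOn f (simplexSet m) := by
  have h0 := hρ.1
  have h1 : 0 < 1 - ρ := sub_pos.2 hρ.2
  have hm : 0 < min ρ (1 - ρ) := lt_min h0 h1
  have hL (y) (hy : y ∈ simplexSet m) :
      min ρ (1 - ρ) ≤ likeL i j (simplexPoint y) ρ := by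
    have hi := simplexPoint_pos hy i
    have hj := simplexPoint_pos hy j
    rw [likeL, mul_div, mul_div, ← add_div, le_div_iff₀ (by positivity), mul_add]
    gcongr
    · exact min_le_left _ _
    · exact min_le_right _ _
  have h := Integrable.bdd_mul (c := (min ρ (1 - ρ))⁻¹)
    (f := fun y ↦ (likeL i j (simplexPoint y) ρ)⁻¹) hf ?_ ?_
  · refine IntegrableOn.congr_fun h (fun y hy ↦ ?_) measurableSet_simplexSet
    exact inv_mul_cancel_left₀ (hm.trans_le (hL y hy)).ne' _
  · have hi := measurable_simplexPoint i
    have hj := measurable_simplexPoint j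
    unfold likeL
    exact Measurable.aestronglyMeasurable (by fun_prop)
  · refine ae_restrict_of_forall_mem measurableSet_simplexSet fun y hy ↦ ?_
    have := hL y hy
    rw [norm_inv, Real.norm_of_nonneg (hm.le.trans this)]
    gcongr

end Simplex

/-- `∫_0^1 ∫_Δ L_{ij} D_α W_{μ,ν} = (μα_i + να_j)/((μ+ν)(α_i+α_j)) · (∫_Δ D_α) (∫_0^1 W_{μ,ν})`. -/
theorem heterogeneous_marginal_likelihood (K : ℕ) (hK : 2 ≤ K)
    (α : Fin K → ℝ) (hα : ∀ k, 0 < α k) (μ ν : ℝ) (hμ : 0 < μ) (hν : 0 < ν)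
    (i j : Fin K) (hij : i ≠ j) :
    dblIntegral K (fun θ ρ => likeL i j θ ρ * dirDensity α θ * betaDensity μ ν ρ)
      = (μ * α i + ν * α j) / ((μ + ν) * (α i + α j))
        * ((∫ y in simplexDomain K, dirDensity α (coordsOf y))
            * ∫ ρ in Set.Ioo (0:ℝ) 1, betaDensity μ ν ρ) := by
  obtain ⟨m, rfl⟩ := Nat.exists_eq_add_of_le' hK
  change (∫ ρ in Set.Ioo (0:ℝ) 1, ∫ y in simplexSet m,
      likeL i j (simplexPoint y) ρ * dirDensity α (simplexPoint y) * betaDensity μ ν ρ)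
    = _ * ((∫ y in simplexSet m, dirDensity α (simplexPoint y)) * _)
  simp only [integral_mul_const]
  by_cases hD : IntegrableOn (fun y ↦ dirDensity α (simplexPoint y)) (simplexSet m)
  · have hi := hα i
    have hj := hα j
    set I := ∫ y in simplexSet m, dirDensity α (simplexPoint y) with hI
    have hinner (ρ : ℝ) :
        ∫ y in simplexSet m, likeL i j (simplexPoint y) ρ * dirDensity α (simplexPoint y)
          = ρ * (α i / (α i + α j) * I) + (1 - ρ) * (α j / (α j + α i) * I) := by
      rw [hI, ← integral_share α hα hij hD, ← integral_share α hα hij.symm hD,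
        ← integral_const_mul, ← integral_const_mul, ← integral_add
          ((integrableOn_share_mul hD).const_mul ρ) ((integrableOn_share_mul hD).const_mul (1 - ρ))]
      congr 1
      ext y
      rw [likeL, add_comm (simplexPoint y j)]
      ring
    have hsplit (ρ : ℝ) :
        (ρ * (α i / (α i + α j) * I) + (1 - ρ) * (α j / (α j + α i) * I)) * betaDensity μ ν ρ
          = ((α i - α j) / (α i + α j) * I) * (ρ * betaDensity μ ν ρ)
            + (α j / (α i + α j) * I) * betaDensity μ ν ρ := by
      rw [add_comm (α j)]
      ring
    simp only [hinner, hsplit]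
    rw [integral_add ((integrableOn_mul_betaDensity hμ hν).const_mul _)
      ((integrableOn_betaDensity hμ hν).const_mul _), integral_const_mul, integral_const_mul,
      integral_mul_betaDensity hμ hν]
    field_simp
    ring
  · rw [integral_undef hD, zero_mul, mul_zero]
    refine setIntegral_eq_zero_of_forall_eq_zero fun ρ hρ ↦ ?_
    rw [integral_undef fun h ↦ hD (integrableOn_of_likeL_mul hρ h), zero_mul]
end
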